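/- Let (x^{LP}, y^{LP}, t^{LP}) be an optimal solution of the relaxation of the adaptive two-stage capacity expansion problem in which the integer acquisition variables x are relaxed to be continuous, let t^{ATS-Relax} := t^{LP} be the resulting revision vector, and let V^{ATS-Relax} denote the optimal value of the (integer) adaptive two-stage capacity expansion problem with the revision times fixed to t^{ATS-Relax}. Let V^{ATS} denote the optimal value of the adaptive two-stage problem with revision times optimized. Then V^{ATS-Relax} − V^{ATS} ≤ Σ_{i=1}^I max_{n ∈ 𝒯_i(t_i^{ATS-Relax})} { ⌈δ_{in}⌉ − δ_{in} } · a_{i1}, where δ_{in} = [A_n y_n^{LP}]_i. -/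

import Mathlib

open scoped Classical

noncomputable section

/-- A scenario tree with `T` stages over a finite node type: a finite rooted tree whose
nodes are partitioned into stages `1, …, T` (the root being the unique stage-1 node),
equipped with strictly positive node probabilities summing to one within each stage and
with each internal node's probability equal to the sum of its children's probabilities. -/
structure ScenarioTree (T : ℕ) (Node : Type) [Fintype Node] [DecidableEq Node] where
  root : Node
  parent : Node → Node
  stage : Node → ℕ
  stage_root : stage root = 1
  stage_pos : ∀ n, 1 ≤ stage n
  stage_le : ∀ n, stage n ≤ T
  root_unique : ∀ n, stage n = 1 → n = root
  parent_root : parent root = root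
  parent_stage : ∀ n, n ≠ root → stage (parent n) + 1 = stage n
  reaches_root : ∀ n, ∃ k : ℕ, parent^[k] n = root
  prob : Node → ℝ
  prob_pos : ∀ n, 0 < prob n
  prob_sum_stage : ∀ t, 1 ≤ t → t ≤ T →
    ∑ n ∈ Finset.univ.filter (fun n => stage n = t), prob n = 1
  prob_children : ∀ n, stage n < T →
    prob n = ∑ m ∈ Finset.univ.filter (fun m => m ≠ root ∧ parent m = n), prob m

namespace ScenarioTree

variable {T : ℕ} {Node : Type} [Fintype Node] [DecidableEq Node]

/-- `m` lies on the unique path from the root to `n` (i.e. `m` is an ancestor of `n`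
or `n` itself); equivalently, `n` belongs to the subtree `𝒯(m)` rooted at `m`. -/
def onPath (tr : ScenarioTree T Node) (m n : Node) : Prop :=
  ∃ k : ℕ, tr.parent^[k] n = m

/-- `P(n)`: the set of nodes on the unique path from the root to `n` (inclusive). -/
def pathSet (tr : ScenarioTree T Node) (n : Node) : Finset Node :=
  Finset.univ.filter fun m => tr.onPath m n

/-- `S_t`: the set of nodes in stage `t`. -/
def stageSet (tr : ScenarioTree T Node) (t : ℕ) : Finset Node :=
  Finset.univ.filter fun n => tr.stage n = t

/-- Objective `∑_{n ∈ 𝒯} p_n a_n x_n` of the single-resource capacity expansion LP. -/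
def lpObj (tr : ScenarioTree T Node) (a x : Node → ℝ) : ℝ :=
  ∑ n, tr.prob n * a n * x n

/-- Feasibility for the single-resource capacity expansion LP:
`x ≥ 0` and `∑_{m ∈ P(n)} x_m ≥ δ_n` for all nodes `n`. -/
def lpFeas (tr : ScenarioTree T Node) (δ x : Node → ℝ) : Prop :=
  (∀ n, 0 ≤ x n) ∧ ∀ n, δ n ≤ ∑ m ∈ tr.pathSet n, x m

/-- Two-stage constraint: `x_m = x_n` for all `m, n` in the same stage. -/
def twoStageConstr (tr : ScenarioTree T Node) (x : Node → ℝ) : Prop :=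
  ∀ m n, tr.stage m = tr.stage n → x m = x n

/-- Adaptive two-stage constraint with revision time `t*`: `x_m = x_n` for all
`m, n ∈ S_t` with `t < t*`, and `x_m = x_n` for all `m, n ∈ S_t ∩ 𝒯(j)` for each
`j ∈ S_{t*}` and each `t ≥ t*`. -/
def adaptiveConstr (tr : ScenarioTree T Node) (tstar : ℕ) (x : Node → ℝ) : Prop :=
  (∀ m n, tr.stage m = tr.stage n → tr.stage m < tstar → x m = x n) ∧
  (∀ j, tr.stage j = tstar → ∀ m n, tr.onPath j m → tr.onPath j n →
    tr.stage m = tr.stage n → x m = x n)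

/-- `v^M`: optimal value of the multi-stage LP. -/
def vM (tr : ScenarioTree T Node) (a δ : Node → ℝ) : ℝ :=
  sInf (tr.lpObj a '' {x | tr.lpFeas δ x})

/-- `v^T`: optimal value of the two-stage LP. -/
def vT (tr : ScenarioTree T Node) (a δ : Node → ℝ) : ℝ :=
  sInf (tr.lpObj a '' {x | tr.lpFeas δ x ∧ tr.twoStageConstr x})

/-- `v^R(t*)`: optimal value of the adaptive two-stage LP with revision time `t*`. -/
def vR (tr : ScenarioTree T Node) (a δ : Node → ℝ) (tstar : ℕ) : ℝ :=
  sInf (tr.lpObj a '' {x | tr.lpFeas δ x ∧ tr.adaptiveConstr tstar x})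

/-- `a_* = min_{n∈𝒯} a_n`. -/
def aMin (tr : ScenarioTree T Node) (a : Node → ℝ) : ℝ := sInf (Set.range a)

/-- `a^* = max_{n∈𝒯} a_n`. -/
def aMax (tr : ScenarioTree T Node) (a : Node → ℝ) : ℝ := sSup (Set.range a)

/-- `δ* = max_{n∈𝒯} δ_n`. -/
def deltaMax (tr : ScenarioTree T Node) (δ : Node → ℝ) : ℝ := sSup (Set.range δ)

/-- `a̲^−(t*) = min{a_n : t_n < t*}`. -/
def aMinusLo (tr : ScenarioTree T Node) (a : Node → ℝ) (tstar : ℕ) : ℝ :=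
  sInf (a '' {n | tr.stage n < tstar})

/-- `a̲^+(t*) = min{a_n : t_n ≥ t*}`. -/
def aPlusLo (tr : ScenarioTree T Node) (a : Node → ℝ) (tstar : ℕ) : ℝ :=
  sInf (a '' {n | tstar ≤ tr.stage n})

/-- `ā^−(t*) = max{a_n : t_n < t*}`. -/
def aMinusHi (tr : ScenarioTree T Node) (a : Node → ℝ) (tstar : ℕ) : ℝ :=
  sSup (a '' {n | tr.stage n < tstar})

/-- `ā^+(t*) = max{a_n : t_n ≥ t*}`. -/
def aPlusHi (tr : ScenarioTree T Node) (a : Node → ℝ) (tstar : ℕ) : ℝ :=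
  sSup (a '' {n | tstar ≤ tr.stage n})

/-- `δ^−(t*) = max_{m ∈ 𝒯(1, t*−1)} δ_m`, the maximum demand before the revision time. -/
def deltaMinus (tr : ScenarioTree T Node) (δ : Node → ℝ) (tstar : ℕ) : ℝ :=
  sSup (δ '' {m | tr.stage m < tstar})

/-- `δ^+(t*) = ∑_{n ∈ S_{t*}} p_n · max_{m ∈ 𝒯(1, t*−1) ∪ 𝒯(n)} δ_m`. -/
def deltaPlus (tr : ScenarioTree T Node) (δ : Node → ℝ) (tstar : ℕ) : ℝ :=
  ∑ n ∈ tr.stageSet tstar, tr.prob n *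
    sSup (δ '' {m | tr.stage m < tstar ∨ tr.onPath n m})

/-- `δ̄ = ∑_{n ∈ S_T} p_n · max_{m ∈ P(n)} δ_m`, the expected maximum demand over scenarios. -/
def deltaBar (tr : ScenarioTree T Node) (δ : Node → ℝ) : ℝ :=
  ∑ n ∈ tr.stageSet T, tr.prob n * sSup (δ '' {m | tr.onPath m n})

end ScenarioTree


section CapacityExpansion

variable {T : ℕ} {Node : Type} [Fintype Node] [DecidableEq Node]
variable {I J K : ℕ}

/-- Objective `∑_{n∈𝒯} p_n (a_n^⊤ x_n + b_n^⊤ y_n)` of the stochastic capacity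
expansion planning problem (`x`: capacity acquisitions, `y`: capacity allocations). -/
def capObj (tr : ScenarioTree T Node) (a : Node → Fin I → ℝ) (b : Node → Fin J → ℝ)
    (x : Node → Fin I → ℝ) (y : Node → Fin J → ℝ) : ℝ :=
  ∑ n, tr.prob n * ((∑ i, a n i * x n i) + (∑ j, b n j * y n j))

/-- Constraints of the stochastic capacity expansion planning problem (with the
integrality of `x` relaxed): `x ≥ 0`, `y ≥ 0`, `A_n y_n ≤ ∑_{m∈P(n)} x_m`, and
`B_n y_n ≥ d_n` for all nodes `n`. -/
def capFeas (tr : ScenarioTree T Node)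
    (A : Node → Matrix (Fin I) (Fin J) ℝ) (B : Node → Matrix (Fin K) (Fin J) ℝ)
    (dem : Node → Fin K → ℝ)
    (x : Node → Fin I → ℝ) (y : Node → Fin J → ℝ) : Prop :=
  (∀ n i, 0 ≤ x n i) ∧ (∀ n j, 0 ≤ y n j) ∧
  (∀ n (i : Fin I), (A n).mulVec (y n) i ≤ ∑ m ∈ tr.pathSet n, x m i) ∧
  (∀ n (k : Fin K), dem n k ≤ (B n).mulVec (y n) k)

/-- Integrality of the capacity acquisition decisions: `x_n ∈ ℤ_+^I`. -/
def capIntegral {Node : Type} (x : Node → Fin I → ℝ) : Prop :=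
  ∀ n i, ∃ z : ℕ, x n i = (z : ℝ)

/-- `V^{TS}`: optimal value of the two-stage stochastic capacity expansion problem. -/
def VTS (tr : ScenarioTree T Node) (a : Node → Fin I → ℝ) (b : Node → Fin J → ℝ)
    (A : Node → Matrix (Fin I) (Fin J) ℝ) (B : Node → Matrix (Fin K) (Fin J) ℝ)
    (dem : Node → Fin K → ℝ) : ℝ :=
  sInf {v : ℝ | ∃ x y, capFeas tr A B dem x y ∧ capIntegral x ∧
    (∀ i : Fin I, tr.twoStageConstr (fun n => x n i)) ∧ v = capObj tr a b x y}

/-- `V^{MS}`: optimal value of the multi-stage stochastic capacity expansion problem. -/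
def VMS (tr : ScenarioTree T Node) (a : Node → Fin I → ℝ) (b : Node → Fin J → ℝ)
    (A : Node → Matrix (Fin I) (Fin J) ℝ) (B : Node → Matrix (Fin K) (Fin J) ℝ)
    (dem : Node → Fin K → ℝ) : ℝ :=
  sInf {v : ℝ | ∃ x y, capFeas tr A B dem x y ∧ capIntegral x ∧ v = capObj tr a b x y}

/-- `V^{ATS}(t*)`: optimal value of the adaptive two-stage stochastic capacity
expansion problem under the given vector `t*` of revision times. -/
def VATS (tr : ScenarioTree T Node) (a : Node → Fin I → ℝ) (b : Node → Fin J → ℝ)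
    (A : Node → Matrix (Fin I) (Fin J) ℝ) (B : Node → Matrix (Fin K) (Fin J) ℝ)
    (dem : Node → Fin K → ℝ) (tstar : Fin I → ℕ) : ℝ :=
  sInf {v : ℝ | ∃ x y, capFeas tr A B dem x y ∧ capIntegral x ∧
    (∀ i : Fin I, tr.adaptiveConstr (tstar i) (fun n => x n i)) ∧ v = capObj tr a b x y}

/-- `V^{ATS}`: optimal value of the adaptive two-stage capacity expansion problem in
which the revision times themselves are optimized. -/
def VATSopt (tr : ScenarioTree T Node) (a : Node → Fin I → ℝ) (b : Node → Fin J → ℝ)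
    (A : Node → Matrix (Fin I) (Fin J) ℝ) (B : Node → Matrix (Fin K) (Fin J) ℝ)
    (dem : Node → Fin K → ℝ) : ℝ :=
  sInf {v : ℝ | ∃ tstar : Fin I → ℕ, (∀ i, 1 ≤ tstar i ∧ tstar i ≤ T) ∧
    v = VATS tr a b A B dem tstar}

/-- The merged demand values `δ̂_n = max_{m ∈ Ĉ_n} δ_m` of the condensed scenario tree
`𝒯_i(t*)`: one value for each stage `t < t*` (all stage-`t` nodes are merged) and one
value for each pair of a node `j ∈ S_{t*}` and a stage `t ≥ t*` (the nodes of
`S_t ∩ 𝒯(j)` are merged). -/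
def ScenarioTree.condensedDemands (tr : ScenarioTree T Node) (δ : Node → ℝ)
    (tstar : ℕ) : Set ℝ :=
  {v | ∃ t, 1 ≤ t ∧ t < tstar ∧ v = sSup (δ '' {m | tr.stage m = t})} ∪
  {v | ∃ j, tr.stage j = tstar ∧ ∃ t, tstar ≤ t ∧ t ≤ T ∧
    v = sSup (δ '' {m | tr.stage m = t ∧ tr.onPath j m})}

/-- `max_{n ∈ 𝒯_i(t*)} (⌈δ_{in}⌉ − δ_{in})`: the maximum integrality (ceiling) gap of
the merged demands over the condensed scenario tree. -/
def ScenarioTree.condGap (tr : ScenarioTree T Node) (δ : Node → ℝ) (tstar : ℕ) : ℝ :=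
  sSup ((fun v => (⌈v⌉ : ℝ) - v) '' tr.condensedDemands δ tstar)

end CapacityExpansion

/-! ### Helper lemmas -/

section Helpers

open MeasureTheory

/-- `f` has mean `c` over `(0,1]`. -/
def HasMean (f : ℝ → ℝ) (c : ℝ) : Prop :=
  IntegrableOn f (Set.Ioc 0 1) volume ∧ ∫ θ in Set.Ioc (0:ℝ) 1, f θ = c

theorem HasMean.add {f g : ℝ → ℝ} {c d : ℝ} (hf : HasMean f c) (hg : HasMean g d) :
    HasMean (fun θ => f θ + g θ) (c + d) :=
  ⟨hf.1.add hg.1, by rw [integral_add hf.1 hg.1, hf.2, hg.2]⟩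

theorem HasMean.sub {f g : ℝ → ℝ} {c d : ℝ} (hf : HasMean f c) (hg : HasMean g d) :
    HasMean (fun θ => f θ - g θ) (c - d) :=
  ⟨hf.1.sub hg.1, by rw [integral_sub hf.1 hg.1, hf.2, hg.2]⟩

theorem HasMean.const_mul {f : ℝ → ℝ} {c : ℝ} (k : ℝ) (hf : HasMean f c) :
    HasMean (fun θ => k * f θ) (k * c) :=
  ⟨Integrable.const_mul hf.1 k, by rw [integral_const_mul, hf.2]⟩

theorem HasMean.const (c : ℝ) : HasMean (fun _ => c) c :=
  ⟨by simp, by simp⟩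

theorem HasMean.sum {ι : Type*} (s : Finset ι) {f : ι → ℝ → ℝ} {c : ι → ℝ}
    (hf : ∀ i, HasMean (f i) (c i)) :
    HasMean (fun θ => ∑ i ∈ s, f i θ) (∑ i ∈ s, c i) :=
  ⟨integrable_finset_sum _ fun i _ => (hf i).1, by
    rw [integral_finset_sum _ fun i _ => (hf i).1]
    exact Finset.sum_congr rfl fun i _ => (hf i).2⟩

theorem HasMean.exists_le {f : ℝ → ℝ} {c : ℝ} (hf : HasMean f c) :
    ∃ θ, 0 < θ ∧ f θ ≤ c := by
  obtain ⟨θ, hθ, h⟩ := exists_le_setAverage (μ := volume) (s := Set.Ioc (0:ℝ) 1)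
    (by simp) (by simp) hf.1
  refine ⟨θ, hθ.1, h.trans ?_⟩
  rw [setAverage_eq, hf.2]
  simp

theorem hasMean_id : HasMean (fun θ => θ) (1/2) := by
  constructor
  · exact (continuous_id.integrableOn_Icc (a := (0:ℝ)) (b := 1)).mono_set Set.Ioc_subset_Icc_self
  · rw [← intervalIntegral.integral_of_le zero_le_one, integral_id]; norm_num

theorem hasMean_fract (c : ℝ) : HasMean (fun θ => Int.fract (c + θ)) (1/2) := by
  constructor
  · refine Integrable.mono' (g := fun _ => (1:ℝ)) (by simp) ?_ ?_
    · exact (measurable_fract.comp (measurable_const.add measurable_id)).aestronglyMeasurable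
    · refine Filter.Eventually.of_forall fun θ => ?_
      rw [Real.norm_of_nonneg (Int.fract_nonneg _)]
      exact (Int.fract_lt_one _).le
  · rw [← intervalIntegral.integral_of_le zero_le_one]
    have h1 : ∫ θ in (0:ℝ)..1, Int.fract (c + θ) = ∫ θ in c..(c+1), Int.fract θ := by
      have := intervalIntegral.integral_comp_add_left (a := (0:ℝ)) (b := 1)
        (fun θ : ℝ => Int.fract θ) c
      simpa using this
    have hp : Function.Periodic (fun θ : ℝ => Int.fract θ) 1 := fun θ => Int.fract_add_one θ
    rw [h1, hp.intervalIntegral_add_eq c 0]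
    have h2 : ∫ θ in (0:ℝ)..(0+1), Int.fract θ = ∫ θ in (0:ℝ)..1, θ := by
      rw [zero_add, intervalIntegral.integral_of_le zero_le_one,
        intervalIntegral.integral_of_le zero_le_one, integral_Ioc_eq_integral_Ioo,
        integral_Ioc_eq_integral_Ioo]
      refine setIntegral_congr_fun measurableSet_Ioo fun θ hθ => ?_
      exact Int.fract_eq_self.2 ⟨hθ.1.le, hθ.2⟩
    rw [h2, integral_id]; norm_num

theorem hasMean_floor (c : ℝ) : HasMean (fun θ => (⌊c + θ⌋ : ℝ)) c := by
  have h := ((HasMean.const c).add hasMean_id).sub (hasMean_fract c)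
  have e : (fun θ : ℝ => (⌊c + θ⌋ : ℝ)) = fun θ => c + θ - Int.fract (c + θ) := by
    funext θ; rw [Int.self_sub_fract]
  rw [e]
  simpa using h

variable {T : ℕ} {Node : Type} [Fintype Node] [DecidableEq Node]

namespace ScenarioTree

theorem onPath_refl (tr : ScenarioTree T Node) (n : Node) : tr.onPath n n := ⟨0, rfl⟩

theorem onPath_iff (tr : ScenarioTree T Node) (j n : Node) :
    tr.onPath j n ↔ j = n ∨ tr.onPath j (tr.parent n) := by
  constructor
  · rintro ⟨k, hk⟩
    cases k with
    | zero => left; exact hk.symm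
    | succ k => right; exact ⟨k, by simpa using hk⟩
  · rintro (rfl | ⟨k, hk⟩)
    · exact tr.onPath_refl _
    · exact ⟨k + 1, by simpa using hk⟩

/-- Induction on the tree. -/
theorem tree_induction (tr : ScenarioTree T Node) {P : Node → Prop} (h0 : P tr.root)
    (h1 : ∀ n, n ≠ tr.root → P (tr.parent n) → P n) (n : Node) : P n := by
  induction hs : tr.stage n using Nat.strong_induction_on generalizing n with
  | _ s ih =>
    by_cases hn : n = tr.root
    · rw [hn]; exact h0
    · have := tr.parent_stage n hn
      exact h1 n hn (ih _ (by omega) _ rfl)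

theorem onPath_root_iff (tr : ScenarioTree T Node) (j : Node) :
    tr.onPath j tr.root ↔ j = tr.root := by
  constructor
  · rintro ⟨k, hk⟩
    rw [Function.iterate_fixed tr.parent_root] at hk
    exact hk.symm
  · rintro rfl; exact tr.onPath_refl _

theorem onPath_stage_le (tr : ScenarioTree T Node) (j n : Node) :
    tr.onPath j n → tr.stage j ≤ tr.stage n := by
  induction n using tr.tree_induction with
  | h0 => rw [onPath_root_iff]; rintro rfl; exact le_rfl
  | h1 n hn ih =>
    rw [onPath_iff]
    rintro (rfl | h)
    · exact le_rfl
    · have := ih h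
      have := tr.parent_stage n hn
      omega

theorem root_onPath (tr : ScenarioTree T Node) (n : Node) : tr.onPath tr.root n :=
  tr.reaches_root n

theorem exists_ancestor (tr : ScenarioTree T Node) (t : ℕ) (ht : 1 ≤ t) (n : Node) :
    t ≤ tr.stage n → ∃ j, tr.stage j = t ∧ tr.onPath j n := by
  induction n using tr.tree_induction with
  | h0 =>
    intro h
    have := tr.stage_root
    exact ⟨tr.root, by omega, tr.onPath_refl _⟩
  | h1 n hn ih =>
    intro h
    have := tr.parent_stage n hn
    by_cases e : t = tr.stage n
    · exact ⟨n, e.symm, tr.onPath_refl _⟩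
    · obtain ⟨j, hj, hp⟩ := ih (by omega)
      exact ⟨j, hj, (tr.onPath_iff _ _).2 (Or.inr hp)⟩

theorem sum_path_root (tr : ScenarioTree T Node) (x : Node → ℝ) :
    ∑ m ∈ tr.pathSet tr.root, x m = x tr.root := by
  have : tr.pathSet tr.root = {tr.root} := by
    ext m; simp [pathSet, onPath_root_iff]
  rw [this, Finset.sum_singleton]

theorem sum_path_succ (tr : ScenarioTree T Node) (x : Node → ℝ) (n : Node) (hn : n ≠ tr.root) :
    ∑ m ∈ tr.pathSet n, x m = x n + ∑ m ∈ tr.pathSet (tr.parent n), x m := by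
  have h : tr.pathSet n = insert n (tr.pathSet (tr.parent n)) := by
    ext m; simp [pathSet, tr.onPath_iff m n]
  rw [h, Finset.sum_insert]
  simp only [pathSet, Finset.mem_filter, Finset.mem_univ, true_and]
  intro h
  have := tr.onPath_stage_le _ _ h
  have := tr.parent_stage n hn
  omega

/-- Nodes that are merged in the condensed tree. -/
def mergeRel (tr : ScenarioTree T Node) (t : ℕ) (m n : Node) : Prop :=
  tr.stage m = tr.stage n ∧
    (tr.stage m < t ∨ ∃ j, tr.stage j = t ∧ tr.onPath j m ∧ tr.onPath j n)

theorem adaptive_iff (tr : ScenarioTree T Node) (t : ℕ) (x : Node → ℝ) :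
    tr.adaptiveConstr t x ↔ ∀ m n, tr.mergeRel t m n → x m = x n := by
  constructor
  · rintro ⟨h1, h2⟩ m n ⟨hs, h | ⟨j, hj, hm, hn⟩⟩
    · exact h1 m n hs h
    · exact h2 j hj m n hm hn hs
  · intro h
    exact ⟨fun m n hs hl => h m n ⟨hs, Or.inl hl⟩,
      fun j hj m n hm hn hs => h m n ⟨hs, Or.inr ⟨j, hj, hm, hn⟩⟩⟩

theorem root_of_stage_eq (tr : ScenarioTree T Node) {m n : Node} (h : tr.stage m = tr.stage n) :
    m = tr.root ↔ n = tr.root := by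
  have := tr.stage_root
  constructor
  · rintro rfl; exact tr.root_unique n (by omega)
  · rintro rfl; exact tr.root_unique m (by omega)

theorem mergeRel_parent (tr : ScenarioTree T Node) {t : ℕ} {m n : Node}
    (h : tr.mergeRel t m n) :
    m = n ∨ (m ≠ tr.root ∧ n ≠ tr.root ∧ tr.mergeRel t (tr.parent m) (tr.parent n)) := by
  obtain ⟨hs, h⟩ := h
  have hr := tr.root_of_stage_eq hs
  by_cases hm : m = tr.root
  · left; rw [hm, hr.1 hm]
  have hn : n ≠ tr.root := fun e => hm (hr.2 e)
  have pm := tr.parent_stage m hm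
  have pn := tr.parent_stage n hn
  rcases h with h | ⟨j, hj, jm, jn⟩
  · exact Or.inr ⟨hm, hn, by omega, Or.inl (by omega)⟩
  · rcases (tr.onPath_iff _ _).1 jm with e | jm'
    · rcases (tr.onPath_iff _ _).1 jn with e' | jn'
      · left; rw [← e, ← e']
      · have := tr.onPath_stage_le _ _ jn'
        subst e; omega
    · rcases (tr.onPath_iff _ _).1 jn with e' | jn'
      · have := tr.onPath_stage_le _ _ jm'
        subst e'; omega
      · exact Or.inr ⟨hm, hn, by omega, Or.inr ⟨j, hj, jm', jn'⟩⟩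

theorem sum_path_adaptive (tr : ScenarioTree T Node) {t : ℕ} {x : Node → ℝ}
    (hx : tr.adaptiveConstr t x) (m : Node) : ∀ n, tr.mergeRel t m n →
    ∑ k ∈ tr.pathSet m, x k = ∑ k ∈ tr.pathSet n, x k := by
  rw [adaptive_iff] at hx
  induction m using tr.tree_induction with
  | h0 =>
    intro n h
    rw [(tr.root_of_stage_eq h.1).1 rfl]
  | h1 m hm ih =>
    intro n h
    rcases tr.mergeRel_parent h with rfl | ⟨_, hn, h'⟩
    · rfl
    · rw [tr.sum_path_succ x m hm, tr.sum_path_succ x n hn, hx m n h, ih _ h']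

/-- Increments of a cumulative function `F` along the tree. -/
def incr (tr : ScenarioTree T Node) (F : Node → ℝ) (n : Node) : ℝ :=
  F n - if n = tr.root then 0 else F (tr.parent n)

theorem sum_incr (tr : ScenarioTree T Node) (F : Node → ℝ) (n : Node) :
    ∑ m ∈ tr.pathSet n, tr.incr F m = F n := by
  induction n using tr.tree_induction with
  | h0 => rw [sum_path_root]; simp [incr]
  | h1 n hn ih => rw [sum_path_succ _ _ _ hn, ih]; simp [incr, hn]

theorem incr_adaptive (tr : ScenarioTree T Node) {t : ℕ} {F : Node → ℝ}
    (hF : ∀ m n, tr.mergeRel t m n → F m = F n) : tr.adaptiveConstr t (tr.incr F) := by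
  rw [adaptive_iff]
  intro m n h
  rcases tr.mergeRel_parent h with rfl | ⟨hm, hn, h'⟩
  · rfl
  · simp [incr, hm, hn, hF _ _ h, hF _ _ h']

theorem condGap_nonneg (tr : ScenarioTree T Node) (δ : Node → ℝ) (t : ℕ) :
    0 ≤ tr.condGap δ t := by
  apply Real.sSup_nonneg
  rintro _ ⟨v, _, rfl⟩
  exact sub_nonneg.2 (Int.le_ceil v)

theorem le_condGap (tr : ScenarioTree T Node) (δ : Node → ℝ) (t : ℕ) {v : ℝ}
    (hv : v ∈ tr.condensedDemands δ t) : (⌈v⌉ : ℝ) - v ≤ tr.condGap δ t := by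
  refine le_csSup ⟨1, ?_⟩ ⟨v, hv, rfl⟩
  rintro _ ⟨w, _, rfl⟩
  have := Int.ceil_lt_add_one w
  show (⌈w⌉ : ℝ) - w ≤ 1
  linarith

/-- Each node's demand is at most an integer that is at most the capacity plus the gap. -/
theorem exists_ceil (tr : ScenarioTree T Node) (δ X : Node → ℝ) (t : ℕ) (ht : 1 ≤ t)
    (hX : ∀ m n, tr.mergeRel t m n → X m = X n) (hδ : ∀ n, δ n ≤ X n) (n : Node) :
    ∃ z : ℤ, δ n ≤ z ∧ (z : ℝ) ≤ X n + tr.condGap δ t := by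
  have key : ∃ S : Set Node, n ∈ S ∧ (∀ m ∈ S, tr.mergeRel t m n) ∧
      sSup (δ '' S) ∈ tr.condensedDemands δ t := by
    by_cases h : tr.stage n < t
    · refine ⟨{m | tr.stage m = tr.stage n}, rfl, ?_, Or.inl ⟨_, tr.stage_pos n, h, rfl⟩⟩
      intro m (hm : tr.stage m = tr.stage n)
      exact ⟨hm, Or.inl (by omega)⟩
    · obtain ⟨j, hj, hjn⟩ := tr.exists_ancestor t ht n (by omega)
      refine ⟨{m | tr.stage m = tr.stage n ∧ tr.onPath j m}, ⟨rfl, hjn⟩, ?_,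
        Or.inr ⟨j, hj, _, by omega, tr.stage_le n, rfl⟩⟩
      rintro m ⟨h1, h2⟩
      exact ⟨h1, Or.inr ⟨j, hj, h2, hjn⟩⟩
  obtain ⟨S, hn, hS, hv⟩ := key
  have h1 : δ n ≤ sSup (δ '' S) :=
    le_csSup (Set.toFinite _).bddAbove ⟨n, hn, rfl⟩
  have h2 : sSup (δ '' S) ≤ X n := by
    refine csSup_le (Set.Nonempty.image _ ⟨n, hn⟩) ?_
    rintro _ ⟨m, hm, rfl⟩
    rw [← hX m n (hS m hm)]
    exact hδ m
  have h3 := tr.le_condGap δ t hv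
  exact ⟨⌈sSup (δ '' S)⌉, h1.trans (Int.le_ceil _), by linarith⟩

theorem prob_root (tr : ScenarioTree T Node) : tr.prob tr.root = 1 := by
  have hT := tr.stage_le tr.root
  rw [tr.stage_root] at hT
  have h := tr.prob_sum_stage 1 le_rfl hT
  have e : Finset.univ.filter (fun n => tr.stage n = 1) = {tr.root} := by
    ext n
    simp only [Finset.mem_filter, Finset.mem_univ, true_and, Finset.mem_singleton]
    exact ⟨tr.root_unique n, fun h => h ▸ tr.stage_root⟩
  rwa [e, Finset.sum_singleton] at h

end ScenarioTree

variable {I J K : ℕ}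

theorem capObj_nonneg (tr : ScenarioTree T Node) (a : Node → Fin I → ℝ) (b : Node → Fin J → ℝ)
    (ha : ∀ n i, 0 ≤ a n i) (hb : ∀ n j, 0 ≤ b n j)
    (x : Node → Fin I → ℝ) (y : Node → Fin J → ℝ)
    (hx : ∀ n i, 0 ≤ x n i) (hy : ∀ n j, 0 ≤ y n j) : 0 ≤ capObj tr a b x y :=
  Finset.sum_nonneg fun n _ => mul_nonneg (tr.prob_pos n).le <|
    add_nonneg (Finset.sum_nonneg fun i _ => mul_nonneg (ha n i) (hx n i))
      (Finset.sum_nonneg fun j _ => mul_nonneg (hb n j) (hy n j))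

/-- The integer problem is feasible for every vector of revision times. -/
theorem exists_integer_feasible (tr : ScenarioTree T Node)
    (A : Node → Matrix (Fin I) (Fin J) ℝ) (B : Node → Matrix (Fin K) (Fin J) ℝ)
    (dem : Node → Fin K → ℝ) (x₀ : Node → Fin I → ℝ) (y : Node → Fin J → ℝ)
    (h : capFeas tr A B dem x₀ y) (t : Fin I → ℕ) :
    ∃ x, capFeas tr A B dem x y ∧ capIntegral x ∧
      ∀ i : Fin I, tr.adaptiveConstr (t i) (fun n => x n i) := by
  let z : Fin I → ℕ := fun i => ∑ n, ⌈(A n).mulVec (y n) i⌉₊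
  have hsum : ∀ n i, ∑ m ∈ tr.pathSet n, (if m = tr.root then (z i : ℝ) else 0) = z i := by
    intro n i
    rw [Finset.sum_ite_eq' (tr.pathSet n) tr.root (fun _ => (z i : ℝ))]
    simp [ScenarioTree.pathSet, tr.root_onPath n]
  refine ⟨fun n i => if n = tr.root then (z i : ℝ) else 0, ⟨?_, h.2.1, ?_, h.2.2.2⟩, ?_, ?_⟩
  · intro n i
    dsimp only
    split_ifs
    · positivity
    · exact le_rfl
  · intro n i
    dsimp only
    rw [hsum]
    refine (Nat.le_ceil _).trans ?_
    exact_mod_cast Finset.single_le_sum (f := fun n => ⌈(A n).mulVec (y n) i⌉₊)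
      (fun _ _ => Nat.zero_le _) (Finset.mem_univ n)
  · intro n i
    dsimp only
    split_ifs
    · exact ⟨_, rfl⟩
    · exact ⟨0, by simp⟩
  · intro i
    rw [ScenarioTree.adaptive_iff]
    intro m n hmn
    have := tr.root_of_stage_eq hmn.1
    simp [this]

/-- Randomized rounding. -/
theorem exists_rounding (tr : ScenarioTree T Node)
    (a : Node → Fin I → ℝ) (b : Node → Fin J → ℝ)
    (A : Node → Matrix (Fin I) (Fin J) ℝ) (B : Node → Matrix (Fin K) (Fin J) ℝ)
    (dem : Node → Fin K → ℝ) (x : Node → Fin I → ℝ) (y : Node → Fin J → ℝ)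
    (h : capFeas tr A B dem x y) (t : Fin I → ℕ) (ht : ∀ i, 1 ≤ t i)
    (hadapt : ∀ i : Fin I, tr.adaptiveConstr (t i) (fun n => x n i)) :
    ∃ x', capFeas tr A B dem x' y ∧ capIntegral x' ∧
      (∀ i : Fin I, tr.adaptiveConstr (t i) (fun n => x' n i)) ∧
      capObj tr a b x' y ≤ capObj tr a b x y + ∑ i : Fin I,
          tr.condGap (fun n => (A n).mulVec (y n) i) (t i) * a tr.root i := by
  set g : Fin I → ℝ := fun i => tr.condGap (fun n => (A n).mulVec (y n) i) (t i) with hg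
  have g0 : ∀ i, 0 ≤ g i := fun i => tr.condGap_nonneg _ _
  let X : Node → Fin I → ℝ := fun n i => ∑ m ∈ tr.pathSet n, x m i
  let F : ℝ → Fin I → Node → ℝ := fun θ i n => (⌊X n i + g i + θ⌋ : ℝ)
  have hXm : ∀ i m n, tr.mergeRel (t i) m n → X m i = X n i := fun i m n hmn =>
    tr.sum_path_adaptive (hadapt i) m n hmn
  -- means
  have mean1 : ∀ n i, HasMean (fun θ => tr.incr (F θ i) n)
      (x n i + if n = tr.root then g i else 0) := by
    intro n i
    by_cases hn : n = tr.root
    · subst hn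
      have := hasMean_floor (X tr.root i + g i)
      have e : X tr.root i = x tr.root i := tr.sum_path_root (fun m => x m i)
      simpa [ScenarioTree.incr, F, e] using this
    · have := (hasMean_floor (X n i + g i)).sub (hasMean_floor (X (tr.parent n) i + g i))
      have e : X n i = x n i + X (tr.parent n) i := tr.sum_path_succ (fun m => x m i) n hn
      have e2 : X n i + g i - (X (tr.parent n) i + g i) = x n i + 0 := by rw [e]; ring
      rw [e2] at this
      simpa [ScenarioTree.incr, F, hn] using this
  have mean2 : HasMean (fun θ => capObj tr a b (fun n i => tr.incr (F θ i) n) y)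
      (capObj tr a b (fun n i => x n i + if n = tr.root then g i else 0) y) := by
    unfold capObj
    exact HasMean.sum _ fun n => HasMean.const_mul _ <|
      (HasMean.sum _ fun i => HasMean.const_mul _ (mean1 n i)).add (HasMean.const _)
  obtain ⟨θ, hθ, hle⟩ := mean2.exists_le
  have nat : ∀ n i, ∃ z : ℕ, tr.incr (F θ i) n = (z : ℝ) := by
    intro n i
    by_cases hn : n = tr.root
    · subst hn
      have e : X tr.root i = x tr.root i := tr.sum_path_root (fun m => x m i)
      have h0 : 0 ≤ ⌊X tr.root i + g i + θ⌋ := by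
        rw [Int.floor_nonneg, e]
        have := h.1 tr.root i
        have := g0 i
        linarith
      obtain ⟨z, hz⟩ := Int.eq_ofNat_of_zero_le h0
      refine ⟨z, ?_⟩
      simp [ScenarioTree.incr, F, hz]
    · have e : X n i = x n i + X (tr.parent n) i := tr.sum_path_succ (fun m => x m i) n hn
      have h0 : 0 ≤ ⌊X n i + g i + θ⌋ - ⌊X (tr.parent n) i + g i + θ⌋ := by
        rw [sub_nonneg]
        apply Int.floor_mono
        have := h.1 n i
        linarith
      obtain ⟨z, hz⟩ := Int.eq_ofNat_of_zero_le h0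
      refine ⟨z, ?_⟩
      have hz' : (⌊X n i + g i + θ⌋ : ℝ) - ⌊X (tr.parent n) i + g i + θ⌋ = z := by
        exact_mod_cast hz
      simp [ScenarioTree.incr, F, hn, hz']
  refine ⟨fun n i => tr.incr (F θ i) n, ⟨?_, h.2.1, ?_, h.2.2.2⟩, nat, ?_, ?_⟩
  · intro n i
    obtain ⟨z, hz⟩ := nat n i
    dsimp only
    rw [hz]; positivity
  · intro n i
    rw [tr.sum_incr (F θ i) n]
    obtain ⟨z, h1, h2⟩ := tr.exists_ceil (fun n => (A n).mulVec (y n) i) (fun n => X n i) (t i)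
      (ht i) (hXm i) (fun n => h.2.2.1 n i) n
    refine h1.trans ?_
    have : z ≤ ⌊X n i + g i + θ⌋ := by
      rw [Int.le_floor]
      have h3 : (z : ℝ) ≤ X n i + g i := h2
      linarith
    show (z : ℝ) ≤ (⌊X n i + g i + θ⌋ : ℝ)
    exact_mod_cast this
  · intro i
    apply tr.incr_adaptive
    intro m n hmn
    simp only [F, hXm i m n hmn]
  · refine hle.trans (le_of_eq ?_)
    have e : ∀ n, tr.prob n * ((∑ i, a n i * (x n i + if n = tr.root then g i else 0)) +
        ∑ j, b n j * y n j) = tr.prob n * ((∑ i, a n i * x n i) + ∑ j, b n j * y n j) +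
        if n = tr.root then ∑ i, g i * a tr.root i else 0 := by
      intro n
      by_cases hn : n = tr.root
      · subst hn
        simp only [if_true, tr.prob_root, mul_add, Finset.sum_add_distrib, one_mul, mul_comm (g _)]
        ring
      · simp [hn]
    unfold capObj
    rw [Finset.sum_congr rfl fun n _ => e n, Finset.sum_add_distrib]
    simp [hg]

end Helpers

/-- **Proposition 11 (approximation guarantee of Algorithm ATS-Relax)**: let
`(x^{LP}, y^{LP}, t^{LP})` be an optimal solution of the relaxation of the adaptive
two-stage capacity expansion problem in which the integrality of `x` is dropped, and
let `V^{ATS-Relax} = V^{ATS}(t^{LP})` be the value of the integer adaptive two-stage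
problem with the revision times fixed to `t^{ATS-Relax} := t^{LP}`.  Then
`V^{ATS-Relax} − V^{ATS} ≤ ∑_i max_{n ∈ 𝒯_i(t_i^{ATS-Relax})}(⌈δ_{in}⌉ − δ_{in}) a_{i1}`
with `δ_{in} = [A_n y^{LP}_n]_i`. -/
theorem ATS_relax_approximation_guarantee
    {T : ℕ} {Node : Type} [Fintype Node] [DecidableEq Node] {I J K : ℕ}
    (tr : ScenarioTree T Node)
    (a : Node → Fin I → ℝ) (b : Node → Fin J → ℝ)
    (A : Node → Matrix (Fin I) (Fin J) ℝ) (B : Node → Matrix (Fin K) (Fin J) ℝ)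
    (dem : Node → Fin K → ℝ)
    (ha : ∀ n i, 0 ≤ a n i) (hb : ∀ n j, 0 ≤ b n j)
    (hA : ∀ n i j, 0 ≤ A n i j) (hB : ∀ n k j, 0 ≤ B n k j)
    (hdem : ∀ n k, 0 ≤ dem n k)
    (xLP : Node → Fin I → ℝ) (yLP : Node → Fin J → ℝ) (tLP : Fin I → ℕ)
    (htLP : ∀ i, 1 ≤ tLP i ∧ tLP i ≤ T)
    (hfeas : capFeas tr A B dem xLP yLP)
    (hadapt : ∀ i : Fin I, tr.adaptiveConstr (tLP i) (fun n => xLP n i))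
    (hopt : capObj tr a b xLP yLP =
      sInf {v : ℝ | ∃ (x : Node → Fin I → ℝ) (y : Node → Fin J → ℝ) (tstar : Fin I → ℕ),
        (∀ i, 1 ≤ tstar i ∧ tstar i ≤ T) ∧ capFeas tr A B dem x y ∧
        (∀ i : Fin I, tr.adaptiveConstr (tstar i) (fun n => x n i)) ∧
        v = capObj tr a b x y}) :
    VATS tr a b A B dem tLP - VATSopt tr a b A B dem
      ≤ ∑ i : Fin I,
          tr.condGap (fun n => (A n).mulVec (yLP n) i) (tLP i) * a tr.root i := by
  have bdd : ∀ t : Fin I → ℕ, BddBelow {v : ℝ | ∃ x y, capFeas tr A B dem x y ∧ capIntegral x ∧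
      (∀ i : Fin I, tr.adaptiveConstr (t i) (fun n => x n i)) ∧ v = capObj tr a b x y} := by
    intro t
    refine ⟨0, ?_⟩
    rintro _ ⟨x, y, hf, _, _, rfl⟩
    exact capObj_nonneg tr a b ha hb x y hf.1 hf.2.1
  have h1 : VATS tr a b A B dem tLP ≤ capObj tr a b xLP yLP + ∑ i : Fin I,
      tr.condGap (fun n => (A n).mulVec (yLP n) i) (tLP i) * a tr.root i := by
    obtain ⟨x', hf, hi, had, hle⟩ := exists_rounding tr a b A B dem xLP yLP hfeas tLP
      (fun i => (htLP i).1) hadapt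
    exact (csInf_le (bdd tLP) ⟨x', yLP, hf, hi, had, rfl⟩).trans hle
  have h2 : capObj tr a b xLP yLP ≤ VATSopt tr a b A B dem := by
    refine le_csInf ⟨_, tLP, htLP, rfl⟩ ?_
    rintro _ ⟨t, ht, rfl⟩
    obtain ⟨x', hf, hi, had⟩ := exists_integer_feasible tr A B dem xLP yLP hfeas t
    refine le_csInf ⟨_, x', yLP, hf, hi, had, rfl⟩ ?_
    rintro _ ⟨x, y, hf, hi, had, rfl⟩
    rw [hopt]
    refine csInf_le ⟨0, ?_⟩ ⟨x, y, t, ht, hf, had, rfl⟩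
    rintro _ ⟨x, y, _, _, hf, _, rfl⟩
    exact capObj_nonneg tr a b ha hb x y hf.1 hf.2.1
  linarith

end
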